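/- Let φ = c₁ ∧ ⋯ ∧ c_m be a 3CNF formula over variables x₁,…,x_n and let M_φ be the HMM constructed from φ. For every assignment α : {x₁,…,x_n} → {⊤,⊥}, the trace τ_α = # · # · α(x₁) · # · α(x₂) · # ⋯ α(x_n) · # · # satisfies R(τ_α) = (1/m) · |{ j ∈ {1,…,m} : α satisfies c_j }|. Consequently, the maximum of R(τ) over all traces τ ∈ L(M_φ) of length 2n+3 equals (1/m) times the maximum number of clauses of φ simultaneously satisfiable by an assignment. -/

import Mathlib

open scoped Classical
open Finset

noncomputable section

/-- A (risk-labelled) hidden Markov model: initial state, transition matrix,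
observation function and risk function.  Stochasticity of the transition
matrix is recorded by the separate predicate `HMM.Stochastic`. -/
structure HMM (S Z : Type) where
  init : S
  P : S → S → NNReal
  obs : S → Z
  r : S → NNReal

namespace HMM

variable {S Z : Type} [Fintype S]

/-- The transition function is a probability distribution in every state. -/
def Stochastic (M : HMM S Z) : Prop := ∀ s : S, ∑ s' : S, M.P s s' = 1

/-- Probability of a path of length `n+1` (a product of `n` transition probabilities). -/
def pathProb (M : HMM S Z) {n : ℕ} (π : Fin (n + 1) → S) : NNReal :=
  ∏ i : Fin n, M.P (π i.castSucc) (π i.succ)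

/-- Paths of length `n+1`: state sequences starting in the initial state. -/
def paths (M : HMM S Z) (n : ℕ) : Finset (Fin (n + 1) → S) :=
  Finset.univ.filter fun π => π 0 = M.init

/-- The trace (observation sequence) of a path. -/
def trace (M : HMM S Z) {n : ℕ} (π : Fin (n + 1) → S) : Fin (n + 1) → Z :=
  fun i => M.obs (π i)

/-- Probability of a trace: the total probability of the paths generating it. -/
def traceProb (M : HMM S Z) {n : ℕ} (τ : Fin (n + 1) → Z) : NNReal :=
  ∑ π ∈ M.paths n, if M.trace π = τ then M.pathProb π else 0

/-- Conditional probability `Pr(π | τ)` (by `NNReal` conventions this is `0`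
whenever `Pr(τ) = 0`). -/
def condProb (M : HMM S Z) {n : ℕ} (π : Fin (n + 1) → S) (τ : Fin (n + 1) → Z) : NNReal :=
  if M.trace π = τ then M.pathProb π / M.traceProb τ else 0

/-- A trace belongs to the language of the HMM iff it has positive probability. -/
def InLang (M : HMM S Z) {n : ℕ} (τ : Fin (n + 1) → Z) : Prop := 0 < M.traceProb τ

/-- The risk of a trace: expected risk of the last state, conditioned on the trace. -/
def traceRisk (M : HMM S Z) {n : ℕ} (τ : Fin (n + 1) → Z) : NNReal :=
  ∑ π ∈ M.paths n, M.condProb π τ * M.r (π (Fin.last n))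

/-- Unsafe traces of length at most `h`, as words over `Z`. -/
def UnsafeSet (M : HMM S Z) (lamU : NNReal) (h : ℕ) : Set (List Z) :=
  { w | ∃ (n : ℕ) (τ : Fin (n + 1) → Z),
      w = List.ofFn τ ∧ n + 1 ≤ h ∧ M.InLang τ ∧ lamU < M.traceRisk τ }

/-- Safe traces of length at most `h`, as words over `Z`. -/
def SafeSet (M : HMM S Z) (lamS : NNReal) (h : ℕ) : Set (List Z) :=
  { w | ∃ (n : ℕ) (τ : Fin (n + 1) → Z),
      w = List.ofFn τ ∧ n + 1 ≤ h ∧ M.InLang τ ∧ M.traceRisk τ < lamS }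

end HMM

/-- The language of a DFA, as a set of words. -/
def dfaLang {Z Q : Type} (A : DFA Z Q) : Set (List Z) := { w | w ∈ A.accepts }

/-- States of the HMM `M_φ` built from a 3CNF formula with `n` variables and
`m` clauses.  `mid i j pr` is the state `s_{i+1,j}` (unprimed for `pr = false`,
primed for `pr = true`) and `lit i j pr b` is the state `s^b_{i+1,j}`
(resp. `s'^b_{i+1,j}`), where `b = true` stands for the literal value `⊤`. -/
inductive PState (n m : ℕ) : Type
  | start : PState n m
  | t : PState n m
  | f : PState n m
  | mid (i : Fin (n + 1)) (j : Fin m) (prime : Bool) : PState n m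
  | lit (i : Fin n) (j : Fin m) (prime : Bool) (b : Bool) : PState n m
deriving DecidableEq, Fintype

/-- The HMM `M_φ` of a 3CNF formula `φ`.  The formula is given by its clauses
`C j : Finset (Fin n × Bool)`, a pair `(i, b)` denoting the literal `x_i`
(for `b = true`) or `¬ x_i` (for `b = false`).  The observations are
`Option Bool`, with `none` playing the role of `#` and `some b` of `⊤`/`⊥`. -/
def satHMM (n m : ℕ) (C : Fin m → Finset (Fin n × Bool)) :
    HMM (PState n m) (Option Bool) where
  init := PState.start
  P := fun x y =>
    match x, y with
    | PState.start, PState.mid i _ pr =>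
        if (i : ℕ) = 0 ∧ pr = false then (m : NNReal)⁻¹ else 0
    | PState.mid i j pr, PState.lit i' j' pr' _ =>
        if (i' : ℕ) = (i : ℕ) ∧ j' = j ∧ pr' = pr ∧ (i : ℕ) < n then 1 / 2 else 0
    | PState.mid i _ pr, PState.t => if (i : ℕ) = n ∧ pr = true then 1 else 0
    | PState.mid i _ pr, PState.f => if (i : ℕ) = n ∧ pr = false then 1 else 0
    | PState.lit i j pr b, PState.mid i' j' pr' =>
        if (i' : ℕ) = (i : ℕ) + 1 ∧ j' = j ∧ pr' = (pr || ((i, b) ∈ C j)) then 1 else 0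
    | PState.t, PState.t => 1
    | PState.f, PState.f => 1
    | _, _ => 0
  obs := fun x =>
    match x with
    | PState.lit _ _ _ b => some b
    | _ => none
  r := fun x => match x with | PState.t => 1 | _ => 0

/-- The assignment `α` satisfies the clause `c`. -/
def SatClause {n : ℕ} (α : Fin n → Bool) (c : Finset (Fin n × Bool)) : Prop :=
  ∃ l ∈ c, α l.1 = l.2

/-- The trace `# · # · α(x₁) · # · α(x₂) · # ⋯ α(x_n) · # · #` of length `2n+3`
associated with an assignment `α`. -/
def assignTrace (n : ℕ) (α : Fin n → Bool) : Fin (2 * n + 3) → Option Bool :=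
  fun i =>
    if hi : 2 ≤ (i : ℕ) ∧ (i : ℕ) % 2 = 0 ∧ (i : ℕ) / 2 ≤ n then
      some (α ⟨(i : ℕ) / 2 - 1, by omega⟩)
    else none

lemma HMM.mem_paths {S Z : Type} [Fintype S] (M : HMM S Z) {n : ℕ} (π : Fin (n + 1) → S) :
    π ∈ M.paths n ↔ π 0 = M.init := by
  simp [HMM.paths]

section SatHMM

variable {n m : ℕ} (C : Fin m → Finset (Fin n × Bool))

/-- Whether one of the first `i` variables makes the clause `c` true under `α`. -/
def satBefore (α : Fin n → Bool) (c : Finset (Fin n × Bool)) (i : ℕ) : Bool :=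
  decide (∃ l ∈ c, (l.1 : ℕ) < i ∧ α l.1 = l.2)

/-- The state sequence of `satHMM n m C` that picks clause `j` and reads the assignment `α`. -/
def satPath (α : Fin n → Bool) (j : Fin m) (k : ℕ) : PState n m :=
  if k = 0 then PState.start
  else if h : k % 2 = 1 ∧ k / 2 ≤ n then
    PState.mid ⟨k / 2, by omega⟩ j (satBefore α (C j) (k / 2))
  else if h : k / 2 - 1 < n then
    PState.lit ⟨k / 2 - 1, h⟩ j (satBefore α (C j) (k / 2 - 1)) (α ⟨k / 2 - 1, h⟩)
  else if satBefore α (C j) n = true then PState.t else PState.f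

/-- The probability of the transition at position `k` of `satPath`. -/
def stepWeight (n m k : ℕ) : NNReal :=
  if k = 0 then (m : NNReal)⁻¹ else if k % 2 = 1 ∧ k / 2 < n then 1 / 2 else 1

/-- The common probability of all the paths `satPath C α j`. -/
def satPathWeight (n m : ℕ) : NNReal := ∏ k : Fin (2 * n + 2), stepWeight n m k

lemma satBefore_zero (α : Fin n → Bool) (c : Finset (Fin n × Bool)) :
    satBefore α c 0 = false := by
  simp [satBefore]

lemma satBefore_succ (α : Fin n → Bool) (c : Finset (Fin n × Bool)) {i : ℕ} (hi : i < n) :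
    satBefore α c (i + 1) = (satBefore α c i || decide (((⟨i, hi⟩ : Fin n), α ⟨i, hi⟩) ∈ c)) := by
  rw [Bool.eq_iff_iff]
  simp only [satBefore, Bool.or_eq_true, decide_eq_true_eq]
  constructor
  · rintro ⟨⟨a, b⟩, hl, hlt, hα⟩
    rcases Nat.lt_succ_iff_lt_or_eq.mp hlt with h | h
    · exact Or.inl ⟨_, hl, h, hα⟩
    · right
      obtain rfl : a = ⟨i, hi⟩ := Fin.ext h
      simp only at hα
      rwa [hα]
  · rintro (⟨l, hl, hlt, hα⟩ | h)
    · exact ⟨l, hl, by omega, hα⟩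
    · exact ⟨_, h, by simp, rfl⟩

lemma satBefore_eq_true_iff (α : Fin n → Bool) (c : Finset (Fin n × Bool)) :
    satBefore α c n = true ↔ SatClause α c := by
  simp [satBefore, SatClause]

lemma satPath_zero (α : Fin n → Bool) (j : Fin m) : satPath C α j 0 = PState.start := by
  simp [satPath]

lemma satPath_odd (α : Fin n → Bool) (j : Fin m) {i : ℕ} (hi : i ≤ n) :
    satPath C α j (2 * i + 1) =
      PState.mid ⟨i, by omega⟩ j (satBefore α (C j) i) := by
  have h : (2 * i + 1) / 2 = i := by omega
  simp [satPath, h, hi, show (2 * i + 1) % 2 = 1 by omega]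

lemma satPath_even (α : Fin n → Bool) (j : Fin m) {i : ℕ} (hi : i < n) :
    satPath C α j (2 * i + 2) =
      PState.lit ⟨i, hi⟩ j (satBefore α (C j) i) (α ⟨i, hi⟩) := by
  simp [satPath, hi]

lemma satPath_last (α : Fin n → Bool) (j : Fin m) :
    satPath C α j (2 * n + 2) =
      if satBefore α (C j) n = true then PState.t else PState.f := by
  simp [satPath]

lemma position_cases {k : ℕ} (hk : k < 2 * n + 2) :
    k = 0 ∨ (∃ i < n, k = 2 * i + 1) ∨ (∃ i < n, k = 2 * i + 2) ∨ k = 2 * n + 1 := by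
  by_cases h0 : k = 0
  · exact Or.inl h0
  by_cases hl : k = 2 * n + 1
  · exact Or.inr (Or.inr (Or.inr hl))
  rcases Nat.mod_two_eq_zero_or_one k with h | h
  · exact Or.inr (Or.inr (Or.inl ⟨k / 2 - 1, by omega, by omega⟩))
  · exact Or.inr (Or.inl ⟨k / 2, by omega, by omega⟩)

lemma transition_satPath (α : Fin n → Bool) (j : Fin m) {k : ℕ} (hk : k < 2 * n + 2) :
    (satHMM n m C).P (satPath C α j k) (satPath C α j (k + 1)) = stepWeight n m k := by
  rcases position_cases hk with rfl | ⟨i, hi, rfl⟩ | ⟨i, hi, rfl⟩ | rfl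
  · have h1 := satPath_odd C α j (Nat.zero_le n)
    simp only [mul_zero] at h1
    rw [satPath_zero, h1]
    simp [satHMM, stepWeight, satBefore_zero]
  · rw [satPath_odd C α j hi.le, satPath_even C α j hi]
    have h : (2 * i + 1) / 2 = i := by omega
    simp [satHMM, stepWeight, h, hi, show (2 * i + 1) % 2 = 1 by omega]
  · rw [satPath_even C α j hi, show 2 * i + 2 + 1 = 2 * (i + 1) + 1 by ring,
      satPath_odd C α j hi]
    simp [satHMM, stepWeight, satBefore_succ α (C j) hi]
  · rw [satPath_odd C α j le_rfl, satPath_last]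
    have h : (2 * n + 1) / 2 = n := by omega
    cases hb : satBefore α (C j) n <;> simp [satHMM, stepWeight, h]

/-- `satPath` is the only continuation of itself that does not observe a value other than `α`'s. -/
lemma eq_satPath_succ (α : Fin n → Bool) (j : Fin m) {k : ℕ} (hk : k < 2 * n + 2) (h0 : k ≠ 0)
    {y : PState n m} (hP : (satHMM n m C).P (satPath C α j k) y ≠ 0)
    (hobs : ∀ i : Fin n, k = 2 * (i : ℕ) + 1 → ∀ b, (satHMM n m C).obs y = some b → b = α i) :
    y = satPath C α j (k + 1) := by
  rcases position_cases hk with rfl | ⟨i, hi, rfl⟩ | ⟨i, hi, rfl⟩ | rfl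
  · exact absurd rfl h0
  · rw [satPath_odd C α j hi.le] at hP
    rw [satPath_even C α j hi]
    cases y <;> simp [satHMM, hi.ne] at hP
    have hb := hobs ⟨i, hi⟩ rfl _ rfl
    obtain ⟨h1, rfl, rfl, -⟩ := hP
    subst hb
    congr 1
    exact Fin.ext h1
  · rw [satPath_even C α j hi] at hP
    rw [show 2 * i + 2 + 1 = 2 * (i + 1) + 1 by ring, satPath_odd C α j hi,
      satBefore_succ α (C j) hi]
    cases y <;> simp [satHMM] at hP
    obtain ⟨h1, rfl, rfl⟩ := hP
    congr 1
    exact Fin.ext h1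
  · rw [satPath_odd C α j le_rfl] at hP
    rw [satPath_last]
    cases y <;> simp_all [satHMM]

lemma stepWeight_ne_zero (hm : 0 < m) (k : ℕ) : stepWeight n m k ≠ 0 := by
  unfold stepWeight
  split_ifs <;> simp [hm.ne']

lemma satPathWeight_ne_zero (hm : 0 < m) : satPathWeight n m ≠ 0 :=
  Finset.prod_ne_zero_iff.mpr fun k _ => stepWeight_ne_zero hm k

lemma pathProb_satPath (α : Fin n → Bool) (j : Fin m) :
    (satHMM n m C).pathProb (n := 2 * n + 2) (fun k => satPath C α j k) = satPathWeight n m :=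
  Finset.prod_congr rfl fun k _ => transition_satPath C α j k.2

lemma trace_satPath (α : Fin n → Bool) (j : Fin m) :
    (satHMM n m C).trace (n := 2 * n + 2) (fun k => satPath C α j k) = assignTrace n α := by
  funext ⟨k, hk⟩
  unfold HMM.trace assignTrace satPath satHMM
  dsimp only
  split_ifs <;> first | rfl | omega

lemma satPath_mem_paths (α : Fin n → Bool) (j : Fin m) :
    (fun k : Fin (2 * n + 2 + 1) => satPath C α j k) ∈ (satHMM n m C).paths (2 * n + 2) :=
  (HMM.mem_paths _ _).mpr (satPath_zero C α j)

lemma satPath_injective (α : Fin n → Bool) :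
    Function.Injective fun (j : Fin m) (k : Fin (2 * n + 2 + 1)) => satPath C α j k := by
  intro j j' h
  have h1 := congrFun h ⟨2 * 0 + 1, by omega⟩
  simp only [satPath_odd C α _ (Nat.zero_le n)] at h1
  injection h1

lemma exists_eq_satPath (α : Fin n → Bool) (π : Fin (2 * n + 2 + 1) → PState n m)
    (hπ : π ∈ (satHMM n m C).paths (2 * n + 2)) (hP : (satHMM n m C).pathProb π ≠ 0)
    (hobs : ∀ (i : Fin n) (b : Bool),
      (satHMM n m C).obs (π ⟨2 * i + 2, by omega⟩) = some b → b = α i) :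
    ∃ j, π = fun k : Fin (2 * n + 2 + 1) => satPath C α j k := by
  have hstep (k : ℕ) (hk : k < 2 * n + 2) :
      (satHMM n m C).P (π ⟨k, by omega⟩) (π ⟨k + 1, by omega⟩) ≠ 0 :=
    Finset.prod_ne_zero_iff.mp hP ⟨k, hk⟩ (Finset.mem_univ _)
  have h0 : π ⟨0, by omega⟩ = PState.start := (HMM.mem_paths _ _).mp hπ
  have h1 : ∃ j, π ⟨1, by omega⟩ = PState.mid ⟨0, by omega⟩ j false := by
    have h := hstep 0 (by omega)
    rw [h0] at h
    generalize π ⟨0 + 1, by omega⟩ = y at h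
    cases y <;> simp [satHMM] at h
    obtain ⟨h1, rfl, -⟩ := h
    exact ⟨_, by congr 1⟩
  obtain ⟨j, hj⟩ := h1
  refine ⟨j, ?_⟩
  have key : ∀ k (hk : k < 2 * n + 2), π ⟨k + 1, by omega⟩ = satPath C α j (k + 1) := by
    intro k
    induction k with
    | zero =>
      intro _
      have h := satPath_odd C α j (Nat.zero_le n)
      rw [satBefore_zero] at h
      exact hj.trans h.symm
    | succ k ih =>
      intro hk
      refine eq_satPath_succ C α j hk (by omega) (ih (by omega) ▸ hstep (k + 1) hk) ?_
      rintro i hi b hb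
      refine hobs i b ?_
      rw [← hb]
      congr 3
      omega
  funext ⟨k, hk⟩
  cases k with
  | zero => exact h0.trans (satPath_zero C α j).symm
  | succ k => exact key k (by omega)

lemma assignTrace_even (α : Fin n → Bool) (i : Fin n) :
    assignTrace n α ⟨2 * i + 2, by omega⟩ = some (α i) := by
  simp [assignTrace]

lemma sum_paths_assignTrace (α : Fin n → Bool) (g : PState n m → NNReal) :
    ∑ π ∈ (satHMM n m C).paths (2 * n + 2),
        (if (satHMM n m C).trace π = assignTrace n α then (satHMM n m C).pathProb π else 0) *
          g (π (Fin.last _)) =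
      satPathWeight n m * ∑ j, g (satPath C α j (2 * n + 2)) := by
  have hsub : Finset.univ.image (fun (j : Fin m) (k : Fin (2 * n + 2 + 1)) => satPath C α j k) ⊆
      (satHMM n m C).paths (2 * n + 2) := by
    intro π hπ
    obtain ⟨j, -, rfl⟩ := Finset.mem_image.mp hπ
    exact satPath_mem_paths C α j
  rw [← Finset.sum_subset hsub, Finset.sum_image (satPath_injective C α).injOn, Finset.mul_sum]
  · refine Finset.sum_congr rfl fun j _ => ?_
    rw [if_pos (trace_satPath C α j), pathProb_satPath]
    rfl
  · intro π hπ hnot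
    by_contra hne
    have hne' := left_ne_zero_of_mul hne
    rw [ne_eq, ite_eq_right_iff, Classical.not_imp] at hne'
    obtain ⟨j, rfl⟩ := exists_eq_satPath C α π hπ hne'.2 fun i b hb => by
      have h := congrFun hne'.1 ⟨2 * i + 2, by omega⟩
      rw [assignTrace_even] at h
      exact Option.some_injective _ (hb.symm.trans h)
    exact hnot (Finset.mem_image_of_mem _ (Finset.mem_univ j))

lemma traceProb_assignTrace (α : Fin n → Bool) :
    (satHMM n m C).traceProb (n := 2 * n + 2) (assignTrace n α) = satPathWeight n m * m := by
  have h := sum_paths_assignTrace C α fun _ => 1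
  simp only [mul_one, Finset.sum_const, Finset.card_univ, Fintype.card_fin, nsmul_eq_mul] at h
  rw [← h, HMM.traceProb]
  exact Finset.sum_congr rfl fun π _ => by congr

lemma traceRisk_assignTrace (hm : 0 < m) (α : Fin n → Bool) :
    (satHMM n m C).traceRisk (n := 2 * n + 2) (assignTrace n α) =
      (m : NNReal)⁻¹ *
        ((Finset.univ.filter fun j : Fin m => SatClause α (C j)).card : NNReal) := by
  have hr (j : Fin m) : (satHMM n m C).r (satPath C α j (2 * n + 2)) =
      if SatClause α (C j) then 1 else 0 := by
    rw [satPath_last]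
    simp only [satBefore_eq_true_iff]
    split_ifs <;> rfl
  have hm' : (m : NNReal) ≠ 0 := by exact_mod_cast hm.ne'
  have hw : satPathWeight n m ≠ 0 := satPathWeight_ne_zero hm
  have hsum := sum_paths_assignTrace C α (satHMM n m C).r
  simp only [hr, Finset.sum_boole] at hsum
  calc (satHMM n m C).traceRisk (n := 2 * n + 2) (assignTrace n α)
      = (∑ π ∈ (satHMM n m C).paths (2 * n + 2),
          (if (satHMM n m C).trace π = assignTrace n α then (satHMM n m C).pathProb π else 0) *
            (satHMM n m C).r (π (Fin.last _))) / (satPathWeight n m * m) := by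
        rw [HMM.traceRisk, Finset.sum_div]
        refine Finset.sum_congr rfl fun π _ => ?_
        rw [HMM.condProb, traceProb_assignTrace]
        split_ifs
        · rw [div_mul_eq_mul_div]
        · simp
    _ = _ := by
        rw [hsum]
        field_simp

lemma inLang_assignTrace (hm : 0 < m) (α : Fin n → Bool) :
    (satHMM n m C).InLang (n := 2 * n + 2) (assignTrace n α) := by
  rw [HMM.InLang, traceProb_assignTrace, pos_iff_ne_zero]
  exact mul_ne_zero (satPathWeight_ne_zero hm) (by exact_mod_cast hm.ne')

lemma exists_assignTrace_eq {τ : Fin (2 * n + 2 + 1) → Option Bool}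
    (hτ : (satHMM n m C).InLang τ) : ∃ α, assignTrace n α = τ := by
  obtain ⟨π, hπ, hne⟩ := Finset.exists_ne_zero_of_sum_ne_zero (ne_of_gt hτ)
  have htr : (satHMM n m C).trace π = τ := by
    by_contra htr
    exact hne (if_neg htr)
  rw [if_pos htr] at hne
  let α : Fin n → Bool := fun i =>
    ((satHMM n m C).obs (π ⟨2 * i + 2, by omega⟩)).getD false
  obtain ⟨j, hj⟩ := exists_eq_satPath C α π hπ hne fun i b hb => by simp only [α, hb, Option.getD]
  exact ⟨α, by rw [← htr, hj, trace_satPath]⟩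

end SatHMM

theorem stmt13 (n m : ℕ) (hm : 0 < m) (C : Fin m → Finset (Fin n × Bool))
    (h3 : ∀ j, (C j).card ≤ 3) :
    -- the risk of the trace of an assignment α is (1/m) · #{j : α satisfies c_j}
    (∀ α : Fin n → Bool,
      (satHMM n m C).traceRisk (assignTrace n α) =
        (m : NNReal)⁻¹ *
          ((Finset.univ.filter fun j : Fin m => SatClause α (C j)).card : NNReal))
    -- hence the maximal risk over all traces of length 2n+3 in L(M_φ) is
    -- (1/m) times the maximal number of simultaneously satisfiable clauses
    ∧ (⨆ τ : {τ : Fin (2 * n + 3) → Option Bool // (satHMM n m C).InLang τ},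
          (satHMM n m C).traceRisk τ.1) =
        (m : NNReal)⁻¹ *
          (⨆ α : Fin n → Bool,
            ((Finset.univ.filter fun j : Fin m => SatClause α (C j)).card : NNReal)) := by
  refine ⟨traceRisk_assignTrace C hm, ?_⟩
  rw [NNReal.mul_iSup]
  symm
  refine Function.Surjective.iSup_congr
    (fun α => (⟨assignTrace n α, inLang_assignTrace C hm α⟩ :
      {τ : Fin (2 * n + 3) → Option Bool // (satHMM n m C).InLang τ})) ?_ ?_
  · rintro ⟨τ, hτ⟩
    obtain ⟨α, hα⟩ := exists_assignTrace_eq C hτ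
    exact ⟨α, Subtype.ext hα⟩
  · exact traceRisk_assignTrace C hm
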